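/- Assume d(n) → ∞, (ln n)/d → 0 and d/n → 0. Then F(n,d,−1,1)^{2/(d−1)} / ln(n/d) → 4π as n → ∞; that is, the expected number of facets satisfies F(n,d,−1,1) = [(4π + o(1))·ln(n/d)]^{(d−1)/2}. -/

import Mathlib

open Filter

noncomputable def c1 (d : ℕ) : ℝ :=
  Real.Gamma ((d : ℝ) / 2) / (Real.sqrt Real.pi * Real.Gamma (((d : ℝ) - 1) / 2))

noncomputable def c2 (d : ℕ) : ℝ :=
  Real.Gamma (((d : ℝ) ^ 2 - 2 * (d : ℝ) + 2) / 2) /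
    (Real.sqrt Real.pi * Real.Gamma (((d : ℝ) ^ 2 - 2 * (d : ℝ) + 1) / 2))

/-- `II n d a b` is the integral `I(n,d,a,b)` from the paper. -/
noncomputable def II (n d : ℕ) (a b : ℝ) : ℝ :=
  ∫ h in a..b, (1 - h ^ 2) ^ (((d : ℝ) ^ 2 - 2 * (d : ℝ) - 1) / 2) *
    (c1 d * ∫ s in (-1 : ℝ)..h, (1 - s ^ 2) ^ (((d : ℝ) - 3) / 2)) ^ (n - d)

/-- `FF n d a b` is the expected number of facets with height in `[a,b]`. -/
noncomputable def FF (n d : ℕ) (a b : ℝ) : ℝ :=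
  (n.choose d : ℝ) * 2 * c2 d * II n d a b

/-- The standard normal CDF. -/
noncomputable def stdPhi (r : ℝ) : ℝ :=
  (Real.sqrt (2 * Real.pi))⁻¹ * ∫ s in Set.Iic r, Real.exp (-s ^ 2 / 2)

/-- The density on `[-1, 1]`: the one-dimensional marginal of the sphere, unnormalized. -/
noncomputable def capDensity (d : ℕ) (s : ℝ) : ℝ := (1 - s ^ 2) ^ (((d : ℝ) - 3) / 2)

/-- The distribution function of the first coordinate of a uniform point on the sphere. -/
noncomputable def capCdf (d : ℕ) (h : ℝ) : ℝ := c1 d * ∫ s in (-1 : ℝ)..h, capDensity d s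

/-- The power of the radius of the slice at height `h` comparable to the mass of the cap. -/
noncomputable def capProfile (d : ℕ) (h : ℝ) : ℝ := (1 - h ^ 2) ^ (((d : ℝ) - 1) / 2)

theorem integral_rpow_mul_one_sub_rpow {a b : ℝ} (ha : 0 < a) (hb : 0 < b) :
    ∫ x in (0 : ℝ)..1, x ^ (a - 1) * (1 - x) ^ (b - 1) =
      Real.Gamma a * Real.Gamma b / Real.Gamma (a + b) := by
  have h := ProbabilityTheory.beta_eq_betaIntegralReal a b ha hb
  rw [ProbabilityTheory.beta] at h
  rw [h, Complex.betaIntegral]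
  have : ∫ x in (0 : ℝ)..1, (x : ℂ) ^ ((a : ℂ) - 1) * (1 - (x : ℂ)) ^ ((b : ℂ) - 1) =
      ∫ x in (0 : ℝ)..1, ((x ^ (a - 1) * (1 - x) ^ (b - 1) : ℝ) : ℂ) := by
    refine intervalIntegral.integral_congr fun x hx => ?_
    rw [Set.uIcc_of_le zero_le_one] at hx
    rw [Complex.ofReal_mul, Complex.ofReal_cpow hx.1, Complex.ofReal_cpow (by linarith [hx.2])]
    push_cast
    rfl
  rw [this, intervalIntegral.integral_ofReal, Complex.ofReal_re]

theorem integral_pow_mul_one_sub_pow_eq_factorial (a b : ℕ) :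
    ∫ x in (0 : ℝ)..1, x ^ a * (1 - x) ^ b =
      (a.factorial : ℝ) * b.factorial / (a + b + 1).factorial := by
  have h := integral_rpow_mul_one_sub_rpow (a := (a : ℝ) + 1) (b := (b : ℝ) + 1)
    (by positivity) (by positivity)
  have e : (a : ℝ) + 1 + (b + 1) = ((a + b + 1 : ℕ) : ℝ) + 1 := by push_cast; ring
  rw [e] at h
  simpa only [Real.Gamma_nat_eq_factorial, add_sub_cancel_right, Real.rpow_natCast] using h

theorem Gamma_add_half_sq_le {x : ℝ} (hx : 0 < x) :
    Real.Gamma (x + 1 / 2) ^ 2 ≤ Real.Gamma x * Real.Gamma (x + 1) := by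
  have h := Real.Gamma_mul_add_mul_le_rpow_Gamma_mul_rpow_Gamma (s := x) (t := x + 1)
    (a := 1 / 2) (b := 1 / 2) hx (by linarith) (by norm_num) (by norm_num) (by norm_num)
  rw [show 1 / 2 * x + 1 / 2 * (x + 1) = x + 1 / 2 by ring, ← Real.sqrt_eq_rpow,
    ← Real.sqrt_eq_rpow] at h
  have h1 := Real.Gamma_pos_of_pos hx
  have h2 := Real.Gamma_pos_of_pos (show 0 < x + 1 by linarith)
  have h3 := Real.Gamma_pos_of_pos (show 0 < x + 1 / 2 by linarith)
  calc Real.Gamma (x + 1 / 2) ^ 2 ≤ (√(Real.Gamma x) * √(Real.Gamma (x + 1))) ^ 2 := by gcongr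
    _ = _ := by rw [mul_pow, Real.sq_sqrt h1.le, Real.sq_sqrt h2.le]

theorem Gamma_ratio_sq_le {x : ℝ} (hx : 0 < x) :
    (Real.Gamma (x + 1 / 2) / Real.Gamma x) ^ 2 ≤ x := by
  have h1 := Real.Gamma_pos_of_pos hx
  have h := Gamma_add_half_sq_le hx
  rw [Real.Gamma_add_one hx.ne'] at h
  rw [div_pow, div_le_iff₀ (by positivity)]
  linarith

theorem le_Gamma_ratio_sq {x : ℝ} (hx : 1 / 2 < x) :
    x - 1 / 2 ≤ (Real.Gamma (x + 1 / 2) / Real.Gamma x) ^ 2 := by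
  have hy : 0 < x - 1 / 2 := by linarith
  have h1 := Real.Gamma_pos_of_pos (show 0 < x by linarith)
  have h2 := Real.Gamma_pos_of_pos hy
  have h := Gamma_add_half_sq_le hy
  have e : Real.Gamma (x + 1 / 2) = (x - 1 / 2) * Real.Gamma (x - 1 / 2) := by
    rw [← Real.Gamma_add_one hy.ne']; ring_nf
  rw [sub_add_cancel, show x - 1 / 2 + 1 = x + 1 / 2 by ring, e] at h
  rw [e, div_pow, le_div_iff₀ (by positivity)]
  nlinarith

theorem c1_pos {d : ℕ} (hd : 3 ≤ d) : 0 < c1 d := by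
  have hd' : (3 : ℝ) ≤ d := by exact_mod_cast hd
  have h1 := Real.Gamma_pos_of_pos (show 0 < (d : ℝ) / 2 by linarith)
  have h2 := Real.Gamma_pos_of_pos (show 0 < ((d : ℝ) - 1) / 2 by linarith)
  unfold c1
  positivity

theorem c2_pos {d : ℕ} (hd : 3 ≤ d) : 0 < c2 d := by
  have hd' : (3 : ℝ) ≤ d := by exact_mod_cast hd
  have h1 := Real.Gamma_pos_of_pos (show 0 < ((d : ℝ) ^ 2 - 2 * d + 2) / 2 by nlinarith)
  have h2 := Real.Gamma_pos_of_pos (show 0 < ((d : ℝ) ^ 2 - 2 * d + 1) / 2 by nlinarith)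
  unfold c2
  positivity

theorem c1_sq_bounds {d : ℕ} (hd : 3 ≤ d) :
    ((d : ℝ) - 2) / (2 * Real.pi) ≤ c1 d ^ 2 ∧ c1 d ^ 2 ≤ ((d : ℝ) - 1) / (2 * Real.pi) := by
  have hd' : (3 : ℝ) ≤ d := by exact_mod_cast hd
  have hpi := Real.pi_pos
  have h1 := Gamma_ratio_sq_le (show 0 < ((d : ℝ) - 1) / 2 by linarith)
  have h2 := le_Gamma_ratio_sq (show 1 / 2 < ((d : ℝ) - 1) / 2 by linarith)
  rw [show ((d : ℝ) - 1) / 2 + 1 / 2 = d / 2 by ring] at h1 h2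
  have e : c1 d ^ 2 = (Real.Gamma ((d : ℝ) / 2) / Real.Gamma (((d : ℝ) - 1) / 2)) ^ 2 / Real.pi := by
    rw [c1, div_pow, div_pow, mul_pow, Real.sq_sqrt hpi.le]
    field_simp
  rw [e]
  constructor
  · rw [le_div_iff₀ hpi]
    calc _ = ((d : ℝ) - 1) / 2 - 1 / 2 := by field_simp; ring
      _ ≤ _ := h2
  · rw [div_le_iff₀ hpi]
    calc _ ≤ _ := h1
      _ = _ := by field_simp

theorem c2_sq_bounds {d : ℕ} (hd : 3 ≤ d) :
    ((d : ℝ) ^ 2 - 2 * d) / (2 * Real.pi) ≤ c2 d ^ 2 ∧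
      c2 d ^ 2 ≤ ((d : ℝ) - 1) ^ 2 / (2 * Real.pi) := by
  have hd' : (3 : ℝ) ≤ d := by exact_mod_cast hd
  have hpi := Real.pi_pos
  have h1 := Gamma_ratio_sq_le (show 0 < ((d : ℝ) ^ 2 - 2 * d + 1) / 2 by nlinarith)
  have h2 := le_Gamma_ratio_sq (show 1 / 2 < ((d : ℝ) ^ 2 - 2 * d + 1) / 2 by nlinarith)
  rw [show ((d : ℝ) ^ 2 - 2 * d + 1) / 2 + 1 / 2 = ((d : ℝ) ^ 2 - 2 * d + 2) / 2 by ring] at h1 h2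
  have e : c2 d ^ 2 = (Real.Gamma (((d : ℝ) ^ 2 - 2 * d + 2) / 2) /
      Real.Gamma (((d : ℝ) ^ 2 - 2 * d + 1) / 2)) ^ 2 / Real.pi := by
    rw [c2, div_pow, div_pow, mul_pow, Real.sq_sqrt hpi.le]
    field_simp
  rw [e]
  constructor
  · rw [le_div_iff₀ hpi]
    calc _ = ((d : ℝ) ^ 2 - 2 * d + 1) / 2 - 1 / 2 := by field_simp; ring
      _ ≤ _ := h2
  · rw [div_le_iff₀ hpi]
    calc _ ≤ _ := h1
      _ = _ := by field_simp; ring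

theorem one_le_c2_div_c1 {d : ℕ} (hd : 3 ≤ d) : 1 ≤ c2 d / c1 d := by
  have hd' : (3 : ℝ) ≤ d := by exact_mod_cast hd
  have h1 := c1_pos hd
  rw [one_le_div h1]
  refine le_of_sq_le_sq ?_ (c2_pos hd).le
  refine (c1_sq_bounds hd).2.trans (le_trans ?_ (c2_sq_bounds hd).1)
  exact div_le_div_of_nonneg_right (by nlinarith) (by positivity)

theorem c2_div_c1_le {d : ℕ} (hd : 3 ≤ d) : c2 d / c1 d ≤ d := by
  have hd' : (3 : ℝ) ≤ d := by exact_mod_cast hd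
  have h1 := c1_pos hd
  rw [div_le_iff₀ h1]
  refine le_of_sq_le_sq ?_ (by positivity)
  refine (c2_sq_bounds hd).2.trans ?_
  rw [mul_pow]
  calc ((d : ℝ) - 1) ^ 2 / (2 * Real.pi) ≤ (d : ℝ) ^ 2 * (d - 2) / (2 * Real.pi) := by
        gcongr; nlinarith
    _ = (d : ℝ) ^ 2 * ((d - 2) / (2 * Real.pi)) := by ring
    _ ≤ _ := by gcongr; exact (c1_sq_bounds hd).1

theorem continuous_capDensity {d : ℕ} (hd : 3 ≤ d) : Continuous (capDensity d) := by
  have hd' : (3 : ℝ) ≤ d := by exact_mod_cast hd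
  unfold capDensity
  exact Continuous.rpow_const (by fun_prop) fun _ => Or.inr (by linarith)

theorem continuous_capProfile {d : ℕ} (hd : 3 ≤ d) : Continuous (capProfile d) := by
  have hd' : (3 : ℝ) ≤ d := by exact_mod_cast hd
  unfold capProfile
  exact Continuous.rpow_const (by fun_prop) fun _ => Or.inr (by linarith)

theorem one_sub_sq_nonneg {s : ℝ} (h1 : -1 ≤ s) (h2 : s ≤ 1) : 0 ≤ 1 - s ^ 2 := by nlinarith

theorem capDensity_nonneg {d : ℕ} {s : ℝ} (h1 : -1 ≤ s) (h2 : s ≤ 1) : 0 ≤ capDensity d s :=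
  Real.rpow_nonneg (one_sub_sq_nonneg h1 h2) _

theorem capProfile_nonneg {d : ℕ} {s : ℝ} (h1 : -1 ≤ s) (h2 : s ≤ 1) : 0 ≤ capProfile d s :=
  Real.rpow_nonneg (one_sub_sq_nonneg h1 h2) _

theorem hasDerivAt_capCdf {d : ℕ} (hd : 3 ≤ d) (h : ℝ) :
    HasDerivAt (capCdf d) (c1 d * capDensity d h) h := by
  have hc := continuous_capDensity hd
  exact (intervalIntegral.integral_hasDerivAt_right (hc.intervalIntegrable _ _)
    (hc.stronglyMeasurableAtFilter _ _) hc.continuousAt).const_mul _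

theorem continuous_capCdf {d : ℕ} (hd : 3 ≤ d) : Continuous (capCdf d) :=
  continuous_iff_continuousAt.2 fun h => (hasDerivAt_capCdf hd h).continuousAt

theorem hasDerivAt_capProfile {d : ℕ} (hd : 3 ≤ d) (s : ℝ) :
    HasDerivAt (capProfile d) (-(((d : ℝ) - 1) * (s * capDensity d s))) s := by
  have hd' : (3 : ℝ) ≤ d := by exact_mod_cast hd
  have h1 : HasDerivAt (fun s : ℝ => 1 - s ^ 2) (-(2 * s)) s := by
    simpa using ((hasDerivAt_id s).pow 2).const_sub 1
  have h2 := h1.rpow_const (p := ((d : ℝ) - 1) / 2) (Or.inr (by linarith))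
  rw [show ((d : ℝ) - 1) / 2 - 1 = ((d : ℝ) - 3) / 2 by ring] at h2
  exact h2.congr_deriv (by simp only [capDensity]; ring)

theorem capCdf_neg_one (d : ℕ) : capCdf d (-1) = 0 := by simp [capCdf]

theorem capCdf_one {d : ℕ} (hd : 3 ≤ d) : capCdf d 1 = 1 := by
  have hd' : (3 : ℝ) ≤ d := by exact_mod_cast hd
  set α : ℝ := ((d : ℝ) - 1) / 2 with hα
  have hα0 : 0 < α := by rw [hα]; linarith
  have hsub : ∫ t in (0 : ℝ)..1, capDensity d (2 * t - 1) =
      (2 : ℝ)⁻¹ * ∫ s in (-1 : ℝ)..1, capDensity d s := by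
    have := intervalIntegral.integral_comp_mul_sub (a := 0) (b := 1) (capDensity d)
      (c := 2) two_ne_zero 1
    rw [this]; norm_num
  have hint : ∫ t in (0 : ℝ)..1, capDensity d (2 * t - 1) =
      4 ^ (α - 1) * ∫ t in (0 : ℝ)..1, t ^ (α - 1) * (1 - t) ^ (α - 1) := by
    rw [← intervalIntegral.integral_const_mul]
    refine intervalIntegral.integral_congr fun t ht => ?_
    rw [Set.uIcc_of_le zero_le_one] at ht
    rw [capDensity, ← Real.mul_rpow ht.1 (by linarith [ht.2]),
      ← Real.mul_rpow (by norm_num) (mul_nonneg ht.1 (by linarith [ht.2]))]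
    congr 1
    · ring
    · rw [hα]; ring
  rw [integral_rpow_mul_one_sub_rpow hα0 hα0, hsub] at hint
  have hdup := Real.Gamma_mul_Gamma_add_half α
  have hpi : 0 < √Real.pi := Real.sqrt_pos.2 Real.pi_pos
  have g1 := Real.Gamma_pos_of_pos hα0
  have g2 := Real.Gamma_pos_of_pos (show 0 < 2 * α by linarith)
  have hpow : (4 : ℝ) ^ (α - 1) * 2 * 2 ^ (1 - 2 * α) = 1 := by
    rw [show (4 : ℝ) = 2 ^ (2 : ℝ) by norm_num, ← Real.rpow_mul (by norm_num)]
    have h2 : (2 : ℝ) ^ (2 * (α - 1)) * 2 = 2 ^ (2 * (α - 1) + 1) := by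
      rw [Real.rpow_add_one two_ne_zero]
    rw [h2, ← Real.rpow_add two_pos, show 2 * (α - 1) + 1 + (1 - 2 * α) = 0 by ring,
      Real.rpow_zero]
  have hint' : ∫ s in (-1 : ℝ)..1, capDensity d s =
      4 ^ (α - 1) * 2 * (Real.Gamma α * Real.Gamma α / Real.Gamma (2 * α)) := by
    rw [two_mul α]; linarith
  rw [capCdf, hint', c1, show (d : ℝ) / 2 = α + 1 / 2 by rw [hα]; ring, ← hα]
  calc _ = (4 ^ (α - 1) * 2) * (Real.Gamma α * Real.Gamma (α + 1 / 2)) /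
        (√Real.pi * Real.Gamma (2 * α)) := by field_simp
    _ = ((4 : ℝ) ^ (α - 1) * 2 * 2 ^ (1 - 2 * α)) * (√Real.pi * Real.Gamma (2 * α)) /
        (√Real.pi * Real.Gamma (2 * α)) := by rw [hdup]; ring
    _ = 1 := by rw [hpow, one_mul, div_self (by positivity)]

theorem one_sub_capCdf {d : ℕ} (hd : 3 ≤ d) (h : ℝ) :
    1 - capCdf d h = c1 d * ∫ s in h..1, capDensity d s := by
  have hc := continuous_capDensity hd
  nth_rewrite 1 [← capCdf_one hd]
  rw [capCdf, capCdf, ← mul_sub, intervalIntegral.integral_interval_sub_left (hc.intervalIntegrable _ _)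
      (hc.intervalIntegrable _ _)]

theorem capCdf_mono {d : ℕ} (hd : 3 ≤ d) {a b : ℝ} (ha : -1 ≤ a) (hab : a ≤ b) (hb : b ≤ 1) :
    capCdf d a ≤ capCdf d b := by
  have hc := continuous_capDensity hd
  refine mul_le_mul_of_nonneg_left ?_ (c1_pos hd).le
  rw [← sub_nonneg, intervalIntegral.integral_interval_sub_left (hc.intervalIntegrable _ _)
      (hc.intervalIntegrable _ _)]
  exact intervalIntegral.integral_nonneg hab fun u hu =>
    capDensity_nonneg (ha.trans hu.1) (hu.2.trans hb)

theorem capCdf_nonneg {d : ℕ} (hd : 3 ≤ d) {h : ℝ} (h1 : -1 ≤ h) (h2 : h ≤ 1) :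
    0 ≤ capCdf d h := by
  rw [← capCdf_neg_one d]
  exact capCdf_mono hd le_rfl h1 h2

theorem capCdf_le_one {d : ℕ} (hd : 3 ≤ d) {h : ℝ} (h1 : -1 ≤ h) (h2 : h ≤ 1) :
    capCdf d h ≤ 1 := by
  rw [← capCdf_one hd]
  exact capCdf_mono hd h1 h2 le_rfl

theorem integral_capCdf_pow {d : ℕ} (hd : 3 ≤ d) (a b : ℕ) :
    ∫ h in (-1 : ℝ)..1, capCdf d h ^ a * (1 - capCdf d h) ^ b * (c1 d * capDensity d h) =
      (a.factorial : ℝ) * b.factorial / (a + b + 1).factorial := by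
  have := intervalIntegral.integral_comp_mul_deriv (a := -1) (b := 1) (f := capCdf d)
    (f' := fun h => c1 d * capDensity d h) (g := fun x => x ^ a * (1 - x) ^ b)
    (fun x _ => hasDerivAt_capCdf hd x)
    ((continuous_capDensity hd).const_mul _).continuousOn (by fun_prop)
  rw [capCdf_neg_one, capCdf_one hd, integral_pow_mul_one_sub_pow_eq_factorial] at this
  simpa using this

theorem FF_eq {n d : ℕ} (hd : 3 ≤ d) :
    FF n d (-1) 1 = (n.choose d : ℝ) * 2 * (c2 d / c1 d) *
      ∫ h in (-1 : ℝ)..1, capProfile d h ^ (d - 2) * capCdf d h ^ (n - d) *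
        (c1 d * capDensity d h) := by
  have hd' : (3 : ℝ) ≤ d := by exact_mod_cast hd
  have hc := c1_pos hd
  have : II n d (-1) 1 = ∫ h in (-1 : ℝ)..1, (c1 d)⁻¹ * (capProfile d h ^ (d - 2) *
      capCdf d h ^ (n - d) * (c1 d * capDensity d h)) := by
    refine intervalIntegral.integral_congr fun h hh => ?_
    rw [Set.uIcc_of_le (by norm_num)] at hh
    have h0 := one_sub_sq_nonneg hh.1 hh.2
    have e : (1 - h ^ 2) ^ (((d : ℝ) ^ 2 - 2 * (d : ℝ) - 1) / 2) =
        capProfile d h ^ (d - 2) * capDensity d h := by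
      rw [capProfile, capDensity, ← Real.rpow_mul_natCast h0,
        Nat.cast_sub (by lia), ← Real.rpow_add_of_nonneg h0]
      · congr 1; push_cast; ring
      · push_cast; nlinarith
      · linarith
    rw [e, capCdf]
    unfold capDensity
    field_simp
  rw [FF, this, intervalIntegral.integral_const_mul]
  ring

theorem integral_mul_capDensity {d : ℕ} (hd : 3 ≤ d) (a b : ℝ) :
    ((d : ℝ) - 1) * ∫ s in a..b, s * capDensity d s = capProfile d a - capProfile d b := by
  have hc := continuous_capDensity hd
  have := intervalIntegral.integral_eq_sub_of_hasDerivAt (a := a) (b := b)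
    (fun x _ => hasDerivAt_capProfile hd x)
    (Continuous.intervalIntegrable (by fun_prop) _ _)
  rw [intervalIntegral.integral_neg, intervalIntegral.integral_const_mul] at this
  linarith

theorem mul_one_sub_capCdf_le {d : ℕ} (hd : 3 ≤ d) {h : ℝ} (h0 : 0 ≤ h) (h1 : h ≤ 1) :
    ((d : ℝ) - 1) * h * (1 - capCdf d h) ≤ c1 d * capProfile d h := by
  have hd' : (3 : ℝ) ≤ d := by exact_mod_cast hd
  have hc := continuous_capDensity hd
  have hI : h * ∫ s in h..1, capDensity d s ≤ ∫ s in h..1, s * capDensity d s := by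
    rw [← intervalIntegral.integral_const_mul]
    refine intervalIntegral.integral_mono_on h1 (Continuous.intervalIntegrable (by fun_prop) _ _)
      (Continuous.intervalIntegrable (by fun_prop) _ _) fun s hs => ?_
    exact mul_le_mul_of_nonneg_right hs.1 (capDensity_nonneg (by linarith [hs.1]) hs.2)
  have hP := integral_mul_capDensity hd h 1
  have hq : 0 ≤ capProfile d 1 := capProfile_nonneg (by norm_num) le_rfl
  rw [one_sub_capCdf hd]
  calc _ = c1 d * (((d : ℝ) - 1) * (h * ∫ s in h..1, capDensity d s)) := by ring
    _ ≤ c1 d * (((d : ℝ) - 1) * ∫ s in h..1, s * capDensity d s) :=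
      mul_le_mul_of_nonneg_left (mul_le_mul_of_nonneg_left hI (by linarith)) (c1_pos hd).le
    _ ≤ _ := mul_le_mul_of_nonneg_left (by linarith) (c1_pos hd).le

theorem le_mul_one_sub_capCdf {d : ℕ} (hd : 3 ≤ d) {h η : ℝ} (h0 : 0 ≤ h) (h1 : h ≤ 1)
    (hη0 : 0 ≤ η) (hη1 : η ≤ 1) :
    c1 d * (capProfile d h * (1 - Real.exp (-(η * ((d : ℝ) - 1) / 2)))) ≤
      ((d : ℝ) - 1) * √(h ^ 2 + η) * (1 - capCdf d h) := by
  have hd' : (3 : ℝ) ≤ d := by exact_mod_cast hd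
  have hc := continuous_capDensity hd
  have hs0 : 0 ≤ 1 - h ^ 2 := one_sub_sq_nonneg (by linarith) h1
  set k := √(h ^ 2 + η * (1 - h ^ 2)) with hk
  have hksq : k ^ 2 = h ^ 2 + η * (1 - h ^ 2) := Real.sq_sqrt (by positivity)
  have hk0 : 0 ≤ k := Real.sqrt_nonneg _
  have hhk : h ≤ k := Real.le_sqrt_of_sq_le (by nlinarith)
  have hk1 : k ≤ 1 := Real.sqrt_le_one.2 (by nlinarith)
  have hkη : k ≤ √(h ^ 2 + η) := Real.sqrt_le_sqrt (by nlinarith [sq_nonneg h])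
  have hI : ∫ s in h..k, s * capDensity d s ≤ k * ∫ s in h..1, capDensity d s := by
    calc _ ≤ ∫ s in h..k, k * capDensity d s := by
          refine intervalIntegral.integral_mono_on hhk
            (Continuous.intervalIntegrable (by fun_prop) _ _)
            (Continuous.intervalIntegrable (by fun_prop) _ _) fun s hs => ?_
          exact mul_le_mul_of_nonneg_right hs.2
            (capDensity_nonneg (by linarith [hs.1]) (hs.2.trans hk1))
      _ = k * ∫ s in h..k, capDensity d s := intervalIntegral.integral_const_mul _ _
      _ ≤ _ := by
          refine mul_le_mul_of_nonneg_left ?_ hk0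
          rw [← intervalIntegral.integral_add_adjacent_intervals (hc.intervalIntegrable h k)
            (hc.intervalIntegrable k 1)]
          have : 0 ≤ ∫ s in k..1, capDensity d s := intervalIntegral.integral_nonneg hk1
            fun u hu => capDensity_nonneg (by linarith [hu.1]) hu.2
          linarith
  have hJ : 0 ≤ ∫ s in h..1, capDensity d s := intervalIntegral.integral_nonneg h1 fun u hu =>
    capDensity_nonneg (by linarith [hu.1]) hu.2
  have hP := integral_mul_capDensity hd h k
  have hqk : capProfile d k ≤ capProfile d h * Real.exp (-(η * ((d : ℝ) - 1) / 2)) := by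
    rw [capProfile, capProfile, hksq,
      show 1 - (h ^ 2 + η * (1 - h ^ 2)) = (1 - h ^ 2) * (1 - η) by ring,
      Real.mul_rpow hs0 (by linarith)]
    refine mul_le_mul_of_nonneg_left ?_ (Real.rpow_nonneg hs0 _)
    calc (1 - η) ^ (((d : ℝ) - 1) / 2) ≤ (Real.exp (-η)) ^ (((d : ℝ) - 1) / 2) :=
          Real.rpow_le_rpow (by linarith) (by linarith [Real.add_one_le_exp (-η)]) (by linarith)
      _ = _ := by rw [← Real.exp_mul]; congr 1; ring
  have hd1 : 0 ≤ (d : ℝ) - 1 := by linarith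
  rw [one_sub_capCdf hd]
  calc _ ≤ c1 d * (((d : ℝ) - 1) * ∫ s in h..k, s * capDensity d s) :=
        mul_le_mul_of_nonneg_left (by linarith) (c1_pos hd).le
    _ ≤ c1 d * (((d : ℝ) - 1) * (√(h ^ 2 + η) * ∫ s in h..1, capDensity d s)) := by
        refine mul_le_mul_of_nonneg_left (mul_le_mul_of_nonneg_left (hI.trans ?_) hd1)
          (c1_pos hd).le
        exact mul_le_mul_of_nonneg_right hkη hJ
    _ = _ := by ring

theorem choose_mul_factorial_div {n d : ℕ} (hd : 3 ≤ d) (hn : d ≤ n) :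
    (n.choose d : ℝ) * ((n - d).factorial * (d - 2).factorial / (n - d + (d - 2) + 1).factorial) =
      n / (d * (d - 1)) := by
  obtain ⟨e, rfl⟩ : ∃ e, d = e + 2 := ⟨d - 2, by lia⟩
  obtain ⟨m, rfl⟩ : ∃ m, n = m + (e + 2) := ⟨n - (e + 2), by lia⟩
  have h := Nat.choose_mul_factorial_mul_factorial hn
  rw [Nat.add_sub_cancel] at h ⊢
  rw [show m + (e + 2) = (m + e + 1) + 1 by ring] at h ⊢
  rw [Nat.add_sub_cancel]
  simp only [Nat.factorial_succ e, Nat.factorial_succ (e + 1), Nat.factorial_succ (m + e + 1)] at h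
  have h' : (((m + e + 1 + 1).choose (e + 2) : ℕ) : ℝ) *
      ((e + 1 + 1) * ((e + 1) * e.factorial)) * m.factorial =
      (m + e + 1 + 1) * (m + e + 1).factorial := by exact_mod_cast h
  have f1 : 0 < ((m + e + 1).factorial : ℝ) := by positivity
  push_cast
  rw [show (e : ℝ) + 2 - 1 = e + 1 by ring, ← mul_div_assoc, div_eq_div_iff f1.ne' (by positivity)]
  linear_combination h'

theorem choose_mul_factorial_div' {n d : ℕ} (hd : 3 ≤ d) (hn : d ≤ n) :
    (n.choose d : ℝ) * ((n - d).factorial * (d - 1).factorial / (n - d + (d - 1) + 1).factorial) =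
      1 / d := by
  obtain ⟨e, rfl⟩ : ∃ e, d = e + 1 := ⟨d - 1, by lia⟩
  have h := Nat.choose_mul_factorial_mul_factorial hn
  rw [Nat.add_sub_cancel, show n - (e + 1) + e + 1 = n by lia]
  rw [Nat.factorial_succ e] at h
  have h' : ((n.choose (e + 1) : ℕ) : ℝ) * ((e + 1) * e.factorial) * (n - (e + 1)).factorial =
      n.factorial := by exact_mod_cast h
  have f1 : 0 < (n.factorial : ℝ) := by positivity
  push_cast
  rw [← mul_div_assoc, div_eq_div_iff f1.ne' (by positivity)]
  linear_combination h'

theorem FF_le {n d : ℕ} (hd : 3 ≤ d) (hn : d ≤ n) {K r : ℝ} (hK : 1 ≤ K) (hr : 0 ≤ r)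
    (hq : ∀ h, -1 ≤ h → h ≤ 1 → capProfile d h ≤ K * (1 - capCdf d h) ∨ capProfile d h ≤ r)
    (hC : (n.choose d : ℝ) * r ^ (d - 2) ≤ 1) :
    FF n d (-1) 1 ≤ 4 * (n : ℝ) ^ 2 * K ^ (d - 1) := by
  have hd' : (3 : ℝ) ≤ d := by exact_mod_cast hd
  have hn' : (d : ℝ) ≤ n := by exact_mod_cast hn
  have hw := continuous_capDensity hd
  have hp := continuous_capProfile hd
  have hΦ := continuous_capCdf hd
  have hI : ∫ h in (-1 : ℝ)..1, capProfile d h ^ (d - 2) * capCdf d h ^ (n - d) *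
        (c1 d * capDensity d h) ≤
      K ^ (d - 2) * ((n - d).factorial * (d - 2).factorial / (n - d + (d - 2) + 1).factorial) +
        r ^ (d - 2) * ((n - d).factorial * Nat.factorial 0 / (n - d + 0 + 1).factorial) := by
    rw [← integral_capCdf_pow hd, ← integral_capCdf_pow hd,
      ← intervalIntegral.integral_const_mul, ← intervalIntegral.integral_const_mul,
      ← intervalIntegral.integral_add (Continuous.intervalIntegrable (by fun_prop) _ _)
        (Continuous.intervalIntegrable (by fun_prop) _ _)]
    refine intervalIntegral.integral_mono_on (by norm_num)
      (Continuous.intervalIntegrable (by fun_prop) _ _)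
      (Continuous.intervalIntegrable (by fun_prop) _ _) fun h hh => ?_
    have q0 := capProfile_nonneg (d := d) hh.1 hh.2
    have F0 := capCdf_nonneg hd hh.1 hh.2
    have F1 := sub_nonneg.2 (capCdf_le_one hd hh.1 hh.2)
    have w0 := mul_nonneg (c1_pos hd).le (capDensity_nonneg (d := d) hh.1 hh.2)
    have hpt : capProfile d h ^ (d - 2) ≤ K ^ (d - 2) * (1 - capCdf d h) ^ (d - 2) +
        r ^ (d - 2) := by
      rcases hq h hh.1 hh.2 with H | H
      · have := pow_le_pow_left₀ q0 H (d - 2)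
        rw [mul_pow] at this
        linarith [pow_nonneg hr (d - 2)]
      · have := pow_le_pow_left₀ q0 H (d - 2)
        have h2 : 0 ≤ K ^ (d - 2) * (1 - capCdf d h) ^ (d - 2) := by positivity
        linarith
    calc _ = capProfile d h ^ (d - 2) * (capCdf d h ^ (n - d) * (c1 d * capDensity d h)) := by ring
      _ ≤ (K ^ (d - 2) * (1 - capCdf d h) ^ (d - 2) + r ^ (d - 2)) *
          (capCdf d h ^ (n - d) * (c1 d * capDensity d h)) :=
        mul_le_mul_of_nonneg_right hpt (by positivity)
      _ = _ := by ring
  have hfac : ((n - d).factorial * Nat.factorial 0 / (n - d + 0 + 1).factorial : ℝ) ≤ 1 := by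
    rw [div_le_one (by positivity)]
    exact_mod_cast (by simpa using Nat.factorial_le (Nat.le_succ (n - d)))
  have hcc := c2_div_c1_le hd
  have hcc1 := one_le_c2_div_c1 hd
  have hKp : 1 ≤ K ^ (d - 2) := one_le_pow₀ hK
  have hKK : K ^ (d - 2) ≤ K ^ (d - 1) := pow_le_pow_right₀ hK (by lia)
  have hN : (n : ℝ) / (d * (d - 1)) ≤ n :=
    div_le_self (by positivity) (by nlinarith)
  rw [FF_eq hd]
  calc _ ≤ (n.choose d : ℝ) * 2 * (c2 d / c1 d) * (K ^ (d - 2) *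
        ((n - d).factorial * (d - 2).factorial / (n - d + (d - 2) + 1).factorial) +
          r ^ (d - 2) * 1) := by
        refine mul_le_mul_of_nonneg_left (hI.trans ?_) (by positivity)
        gcongr
    _ = 2 * (c2 d / c1 d) * (K ^ (d - 2) * ((n.choose d : ℝ) *
        ((n - d).factorial * (d - 2).factorial / (n - d + (d - 2) + 1).factorial)) +
          (n.choose d : ℝ) * r ^ (d - 2)) := by ring
    _ ≤ 2 * (n : ℝ) * (K ^ (d - 1) * n + K ^ (d - 1) * n) := by
        rw [choose_mul_factorial_div hd hn]
        have h1 : 1 ≤ K ^ (d - 1) * n := by nlinarith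
        have h3 : 0 ≤ (n : ℝ) / (d * (d - 1)) := by
          apply div_nonneg (by positivity); nlinarith
        have h2 : K ^ (d - 2) * (n / (d * (d - 1))) ≤ K ^ (d - 1) * n := by gcongr
        refine mul_le_mul (by linarith) (by linarith) ?_ (by positivity)
        positivity
    _ = _ := by ring

theorem le_FF {n d : ℕ} (hd : 3 ≤ d) (hn : d ≤ n) {K p : ℝ} (hK : 0 < K) (hKn : K ≤ n)
    (hp : 2 * d / n ≤ p)
    (hq : ∀ h, -1 ≤ h → h ≤ 1 → 1 - capCdf d h < p → K * (1 - capCdf d h) ≤ capProfile d h) :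
    K ^ (d - 1) / (n : ℝ) ^ 2 ≤ FF n d (-1) 1 := by
  have hd' : (3 : ℝ) ≤ d := by exact_mod_cast hd
  have hn' : (d : ℝ) ≤ n := by exact_mod_cast hn
  have hn0 : (0 : ℝ) < n := by linarith
  have hp0 : 0 < p := lt_of_lt_of_le (by positivity) hp
  have hw := continuous_capDensity hd
  have hp := continuous_capProfile hd
  have hΦ := continuous_capCdf hd
  have hI : K ^ (d - 2) *
        ((n - d).factorial * (d - 2).factorial / (n - d + (d - 2) + 1).factorial) -
      K ^ (d - 2) * p⁻¹ *
        ((n - d).factorial * (d - 1).factorial / (n - d + (d - 1) + 1).factorial) ≤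
      ∫ h in (-1 : ℝ)..1, capProfile d h ^ (d - 2) * capCdf d h ^ (n - d) *
        (c1 d * capDensity d h) := by
    rw [← integral_capCdf_pow hd, ← integral_capCdf_pow hd,
      ← intervalIntegral.integral_const_mul, ← intervalIntegral.integral_const_mul,
      ← intervalIntegral.integral_sub (Continuous.intervalIntegrable (by fun_prop) _ _)
        (Continuous.intervalIntegrable (by fun_prop) _ _)]
    refine intervalIntegral.integral_mono_on (by norm_num)
      (Continuous.intervalIntegrable (by fun_prop) _ _)
      (Continuous.intervalIntegrable (by fun_prop) _ _) fun h hh => ?_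
    have q0 := capProfile_nonneg (d := d) hh.1 hh.2
    have F0 := capCdf_nonneg hd hh.1 hh.2
    have F1 := sub_nonneg.2 (capCdf_le_one hd hh.1 hh.2)
    have w0 := mul_nonneg (c1_pos hd).le (capDensity_nonneg (d := d) hh.1 hh.2)
    have hpt : (K * (1 - capCdf d h)) ^ (d - 2) * (1 - p⁻¹ * (1 - capCdf d h)) ≤
        capProfile d h ^ (d - 2) := by
      rcases lt_or_ge (1 - capCdf d h) p with H | H
      · have h1 := pow_le_pow_left₀ (by positivity) (hq h hh.1 hh.2 H) (d - 2)
        refine le_trans (mul_le_of_le_one_right (by positivity) ?_) h1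
        have : 0 ≤ p⁻¹ * (1 - capCdf d h) := by positivity
        linarith
      · refine le_trans (mul_nonpos_of_nonneg_of_nonpos (by positivity) ?_) (pow_nonneg q0 _)
        have : 1 ≤ p⁻¹ * (1 - capCdf d h) := by
          rwa [inv_mul_eq_div, one_le_div hp0]
        linarith
    have e : d - 1 = (d - 2) + 1 := by lia
    calc _ = (K * (1 - capCdf d h)) ^ (d - 2) * (1 - p⁻¹ * (1 - capCdf d h)) *
          (capCdf d h ^ (n - d) * (c1 d * capDensity d h)) := by
          rw [e, pow_succ, mul_pow]; ring
      _ ≤ capProfile d h ^ (d - 2) * (capCdf d h ^ (n - d) * (c1 d * capDensity d h)) :=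
        mul_le_mul_of_nonneg_right hpt (by positivity)
      _ = _ := by ring
  have hcc1 := one_le_c2_div_c1 hd
  have hpinv : p⁻¹ ≤ n / (2 * d) := by
    rw [inv_le_comm₀ hp0 (by positivity), inv_div]; assumption
  have hKpow : K ^ (d - 1) = K ^ (d - 2) * K := by
    rw [← pow_succ]; congr 1; lia
  have hbr : 1 / (2 * (n : ℝ)) ≤ n / (d * (d - 1)) - p⁻¹ * (1 / d) := by
    calc 1 / (2 * (n : ℝ)) ≤ 1 / (2 * (d : ℝ)) := by gcongr
      _ ≤ n / (2 * d * d) := by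
        rw [div_le_div_iff₀ (by positivity) (by positivity)]; nlinarith
      _ = n / (d * d) - n / (2 * d) * (1 / d) := by field_simp; ring
      _ ≤ n / (d * (d - 1)) - p⁻¹ * (1 / d) := by
        have : (n : ℝ) / (d * d) ≤ n / (d * (d - 1)) := by
          apply div_le_div_of_nonneg_left hn0.le
          · nlinarith
          · nlinarith
        have : p⁻¹ * (1 / d) ≤ n / (2 * d) * (1 / d) := by gcongr
        linarith
  rw [FF_eq hd]
  calc K ^ (d - 1) / (n : ℝ) ^ 2 ≤ 2 * (K ^ (d - 2) * (1 / (2 * (n : ℝ)))) := by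
        rw [hKpow, div_le_iff₀ (by positivity)]
        calc K ^ (d - 2) * K ≤ K ^ (d - 2) * n := by gcongr
          _ = _ := by field_simp
    _ ≤ 2 * (c2 d / c1 d) * (K ^ (d - 2) * (n / (d * (d - 1)) - p⁻¹ * (1 / d))) := by
        refine mul_le_mul (by linarith) ?_ (by positivity) (by positivity)
        gcongr
    _ = (n.choose d : ℝ) * 2 * (c2 d / c1 d) * (K ^ (d - 2) *
        ((n - d).factorial * (d - 2).factorial / (n - d + (d - 2) + 1).factorial) -
      K ^ (d - 2) * p⁻¹ *
        ((n - d).factorial * (d - 1).factorial / (n - d + (d - 1) + 1).factorial)) := by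
        rw [← choose_mul_factorial_div hd hn, ← choose_mul_factorial_div' hd hn]; ring
    _ ≤ _ := mul_le_mul_of_nonneg_left hI (by positivity)

theorem FF_nonneg {n d : ℕ} (hd : 3 ≤ d) : 0 ≤ FF n d (-1) 1 := by
  rw [FF_eq hd]
  have := one_le_c2_div_c1 hd
  refine mul_nonneg (by positivity) (intervalIntegral.integral_nonneg (by norm_num) fun h hh => ?_)
  have q0 := capProfile_nonneg (d := d) hh.1 hh.2
  have F0 := capCdf_nonneg hd hh.1 hh.2
  have w0 := mul_nonneg (c1_pos hd).le (capDensity_nonneg (d := d) hh.1 hh.2)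
  positivity

theorem pow_sub_one_rpow_two_div {d : ℕ} (hd : 2 ≤ d) {K : ℝ} (hK : 0 ≤ K) :
    (K ^ (d - 1)) ^ (2 / ((d : ℝ) - 1)) = K ^ 2 := by
  have hd' : (2 : ℝ) ≤ d := by exact_mod_cast hd
  have hne : (d : ℝ) - 1 ≠ 0 := by linarith
  rw [← Real.rpow_natCast, ← Real.rpow_mul hK, Nat.cast_sub (by lia), Nat.cast_one,
    mul_div_cancel₀ _ hne]
  exact_mod_cast Real.rpow_natCast K 2

theorem choose_mul_exp_pow_le_one {n d : ℕ} (hd : 3 ≤ d) (hn : d ≤ n) {ε L : ℝ}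
    (hL : L = Real.log (n / d)) (hL0 : 0 ≤ L) (h1 : 4 * (1 + ε) ≤ ε * d) (h2 : 2 ≤ ε * L) :
    (n.choose d : ℝ) * Real.exp (-((1 + ε) * L)) ^ (d - 2) ≤ 1 := by
  have hd' : (3 : ℝ) ≤ d := by exact_mod_cast hd
  have hn' : (d : ℝ) ≤ n := by exact_mod_cast hn
  have hd0 : (0 : ℝ) < d := by linarith
  have hn0 : (0 : ℝ) < n := by linarith
  have hexp : Real.exp L = n / d := by rw [hL, Real.exp_log (by positivity)]
  have hC : (n.choose d : ℝ) ≤ Real.exp (d + d * L) := by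
    calc (n.choose d : ℝ) ≤ (n : ℝ) ^ d / d.factorial := Nat.choose_le_pow_div d n
      _ = ((d : ℝ) ^ d / d.factorial) * (n / d) ^ d := by rw [div_pow]; field_simp
      _ ≤ Real.exp d * (n / d) ^ d := by
        gcongr
        exact Real.pow_div_factorial_le_exp _ hd0.le d
      _ = _ := by rw [← hexp, ← Real.exp_nat_mul, ← Real.exp_add]
  calc _ ≤ Real.exp (d + d * L) * Real.exp (-((1 + ε) * L)) ^ (d - 2) := by gcongr
    _ = Real.exp (d + d * L + ((d : ℝ) - 2) * -((1 + ε) * L)) := by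
      rw [← Real.exp_nat_mul, ← Real.exp_add, Nat.cast_sub (by lia), Nat.cast_ofNat]
    _ ≤ 1 := by
      rw [Real.exp_le_one_iff]
      nlinarith [mul_le_mul_of_nonneg_right h1 hL0, mul_le_mul_of_nonneg_right h2 hd0.le]

theorem FF_rpow_div_le {n d : ℕ} (hd : 3 ≤ d) (hn : d ≤ n) {ε L : ℝ} (hε : 0 < ε)
    (hL : L = Real.log (n / d)) (hL1 : 1 ≤ L) (h1 : 4 * (1 + ε) ≤ ε * d) (h2 : 2 ≤ ε * L)
    (h3 : 2 * (1 + 2 * ε) * (L / (d - 1)) ≤ 1) :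
    FF n d (-1) 1 ^ (2 / ((d : ℝ) - 1)) / L ≤
      4 * Real.pi * (1 + 2 * ε) * ((d - 1) / (d - 2)) / (1 - Real.exp (-(ε * L))) ^ 2 *
        (4 * (n : ℝ) ^ 2) ^ (2 / ((d : ℝ) - 1)) := by
  have hd' : (3 : ℝ) ≤ d := by exact_mod_cast hd
  have hd1 : 0 < (d : ℝ) - 1 := by linarith
  have hd2 : 0 < (d : ℝ) - 2 := by linarith
  have hpi := Real.pi_gt_three
  have hL0 : 0 < L := by linarith
  have hc := c1_pos hd
  obtain ⟨hc1, hc2⟩ := c1_sq_bounds hd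
  set t := L / ((d : ℝ) - 1) with ht
  have ht0 : 0 < t := by positivity
  set E := 1 - Real.exp (-(ε * L)) with hE
  have hE0 : 0 < E := by
    rw [hE, sub_pos, Real.exp_lt_one_iff]
    have := mul_pos hε hL0
    linarith
  have hE1 : E ≤ 1 := by linarith [Real.exp_pos (-(ε * L))]
  set H := √(2 * (1 + ε) * t) with hH
  have hHsq : H ^ 2 = 2 * (1 + ε) * t := Real.sq_sqrt (by positivity)
  have hH0 : 0 ≤ H := Real.sqrt_nonneg _
  have hH1 : H ≤ 1 := Real.sqrt_le_one.2 (by nlinarith)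
  set S := √(H ^ 2 + 2 * ε * t) with hS
  have hSsq : S ^ 2 = 2 * (1 + 2 * ε) * t := by
    rw [hS, Real.sq_sqrt (by positivity), hHsq]; ring
  have hS0 : 0 < S := Real.sqrt_pos.2 (by positivity)
  set K := ((d : ℝ) - 1) * S / (c1 d * E) with hK
  have hK0 : 0 < K := by positivity
  have hKsq : K ^ 2 = 2 * (1 + 2 * ε) * L * (d - 1) / (c1 d ^ 2 * E ^ 2) := by
    rw [hK, div_pow, mul_pow, mul_pow, hSsq, ht]; field_simp
  have hK1 : 1 ≤ K := by
    refine (one_le_sq_iff₀ hK0.le).1 ?_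
    rw [hKsq, one_le_div (by positivity)]
    calc c1 d ^ 2 * E ^ 2 ≤ (((d : ℝ) - 1) / (2 * Real.pi)) * 1 := by
          gcongr; exact pow_le_one₀ hE0.le hE1
      _ ≤ (d : ℝ) - 1 := by
          rw [mul_one]; exact div_le_self hd1.le (by linarith)
      _ ≤ _ := by
          refine le_mul_of_one_le_left hd1.le ?_
          nlinarith
  have hmills : ∀ h, 0 ≤ h → h ≤ H → capProfile d h ≤ K * (1 - capCdf d h) := by
    intro h h0 hh
    have hM := le_mul_one_sub_capCdf hd h0 (hh.trans hH1) (η := 2 * ε * t) (by positivity)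
      (by nlinarith)
    have e : 2 * ε * t * ((d : ℝ) - 1) / 2 = ε * L := by rw [ht]; field_simp
    rw [e, ← hE] at hM
    have hp := sub_nonneg.2 (capCdf_le_one hd (by linarith) (hh.trans hH1))
    have hs : √(h ^ 2 + 2 * ε * t) ≤ S := Real.sqrt_le_sqrt (by gcongr)
    rw [hK, div_mul_eq_mul_div, le_div_iff₀ (by positivity)]
    calc _ = c1 d * (capProfile d h * E) := by ring
      _ ≤ _ := hM
      _ ≤ _ := by gcongr
  have hq : ∀ h, -1 ≤ h → h ≤ 1 → capProfile d h ≤ K * (1 - capCdf d h) ∨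
      capProfile d h ≤ Real.exp (-((1 + ε) * L)) := by
    intro h hl hr
    rcases le_total h 0 with h0 | h0
    · left
      calc capProfile d h ≤ 1 :=
            Real.rpow_le_one (one_sub_sq_nonneg hl hr) (by nlinarith) (by linarith)
        _ = capProfile d 0 := by simp [capProfile]
        _ ≤ K * (1 - capCdf d 0) := hmills 0 le_rfl hH0
        _ ≤ _ := by
          have := capCdf_mono hd hl h0 zero_le_one
          gcongr
    rcases le_total h H with hh | hh
    · exact Or.inl (hmills h h0 hh)
    · right
      calc capProfile d h ≤ Real.exp (-(2 * (1 + ε) * t)) ^ (((d : ℝ) - 1) / 2) := by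
            refine Real.rpow_le_rpow (one_sub_sq_nonneg hl hr) ?_ (by linarith)
            have := Real.add_one_le_exp (-(2 * (1 + ε) * t))
            nlinarith
        _ = _ := by
          rw [← Real.exp_mul, ht]; congr 1; field_simp
  have hF := FF_le hd hn hK1 (Real.exp_pos _).le hq (choose_mul_exp_pow_le_one hd hn hL hL0.le h1 h2)
  have hF' := Real.rpow_le_rpow (FF_nonneg hd) hF (show 0 ≤ 2 / ((d : ℝ) - 1) by positivity)
  rw [Real.mul_rpow (by positivity) (by positivity), pow_sub_one_rpow_two_div (by lia) hK0.le] at hF'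
  rw [div_le_iff₀ hL0]
  refine hF'.trans ?_
  rw [mul_comm, mul_right_comm]
  refine mul_le_mul_of_nonneg_right ?_ (by positivity)
  rw [hKsq]
  calc _ ≤ 2 * (1 + 2 * ε) * L * (d - 1) / ((((d : ℝ) - 2) / (2 * Real.pi)) * E ^ 2) := by gcongr
    _ = _ := by field_simp; ring

theorem neg_mul_le_log_one_sub {ε x : ℝ} (hε1 : ε < 1) (hx0 : 0 ≤ x) (hx : x ≤ ε / 2) :
    -((1 + ε) * x) ≤ Real.log (1 - x) := by
  have hpos : 0 < 1 - x := by linarith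
  have hlog := Real.one_sub_inv_le_log_of_pos hpos
  have hinv : (1 - x)⁻¹ ≤ 1 + (1 + ε) * x := by
    rw [inv_le_iff_one_le_mul₀ hpos]
    have h1 : (1 + ε) * x ≤ 2 * x := by gcongr; linarith
    have h2 : 0 ≤ x * (ε - (1 + ε) * x) := mul_nonneg hx0 (by linarith)
    linarith
  linarith

set_option maxHeartbeats 1000000 in
theorem le_FF_rpow_div {n d : ℕ} (hd : 4 ≤ d) (hn : d ≤ n) {ε L : ℝ} (hε : 0 < ε) (hε1 : ε < 1)
    (hL : L = Real.log (n / d)) (hL1 : 1 ≤ L) (h1 : 2 * (L / (d - 1)) ≤ ε / 2)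
    (h2 : Real.exp (-(ε * L)) ≤ 1 / 2) (h3 : 128 * Real.pi * L ≤ Real.exp (2 * (ε ^ 2 * L))) :
    4 * Real.pi * (1 - ε) / ((n : ℝ) ^ 2) ^ (2 / ((d : ℝ) - 1)) ≤
      FF n d (-1) 1 ^ (2 / ((d : ℝ) - 1)) / L := by
  have hd3 : 3 ≤ d := by lia
  have hd' : (4 : ℝ) ≤ d := by exact_mod_cast hd
  have hn' : (d : ℝ) ≤ n := by exact_mod_cast hn
  have hn0 : 0 < (n : ℝ) := by linarith
  have hd1 : 0 < (d : ℝ) - 1 := by linarith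
  have hd2 : 0 < (d : ℝ) - 2 := by linarith
  have hpi := Real.pi_pos
  have hpi4 := Real.pi_lt_four
  have hL0 : 0 < L := by linarith
  have hc := c1_pos hd3
  have hε' : 0 < 1 - ε := by linarith
  obtain ⟨hc1, hc2⟩ := c1_sq_bounds hd3
  set t := L / ((d : ℝ) - 1) with ht
  have ht0 : 0 < t := by positivity
  have htL : t * (d - 1) = L := by rw [ht]; field_simp
  set E := 1 - Real.exp (-(ε * L)) with hE
  have hE0 : 1 / 2 ≤ E := by linarith
  set H := √(2 * (1 - ε) * t) with hH
  have hHsq : H ^ 2 = 2 * (1 - ε) * t := Real.sq_sqrt (by positivity)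
  have hH0 : 0 < H := Real.sqrt_pos.2 (by positivity)
  have hHε : H ^ 2 ≤ ε / 2 := by nlinarith
  have hH1 : H ≤ 1 := Real.sqrt_le_one.2 (by nlinarith)
  set S := √(H ^ 2 + 2 * ε * t) with hS
  have hSsq : S ^ 2 = 2 * t := by
    rw [hS, Real.sq_sqrt (by positivity), hHsq]; ring
  have hS0 : 0 < S := Real.sqrt_pos.2 (by positivity)
  set K := ((d : ℝ) - 1) * H / c1 d with hK
  have hK0 : 0 < K := by positivity
  have hKsq : K ^ 2 = 2 * (1 - ε) * L * (d - 1) / c1 d ^ 2 := by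
    rw [hK, div_pow, mul_pow, hHsq, ← htL]; field_simp
  have hKn : K ≤ n := by
    refine le_trans (le_of_sq_le_sq ?_ (by linarith)) hn'
    rw [hKsq, div_le_iff₀ (by positivity)]
    have hLd : L ≤ (d - 1) / 4 := by nlinarith
    calc 2 * (1 - ε) * L * ((d : ℝ) - 1) ≤ 2 * 1 * ((d - 1) / 4) * (d - 1) := by
          gcongr; linarith
      _ ≤ (d : ℝ) ^ 2 * ((d - 2) / 8) := by nlinarith [mul_pos hd1 hd2]
      _ ≤ (d : ℝ) ^ 2 * ((d - 2) / (2 * Real.pi)) := by gcongr; linarith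
      _ ≤ _ := by gcongr
  have hprof : Real.exp (-L) * Real.exp (ε ^ 2 * L) ≤ capProfile d H := by
    rw [← Real.exp_add, capProfile]
    have hpos : 0 < 1 - H ^ 2 := by linarith
    rw [Real.rpow_def_of_pos hpos, Real.exp_le_exp]
    have hlog := neg_mul_le_log_one_sub hε1 (sq_nonneg H) hHε
    have e : (1 + ε) * H ^ 2 * (((d : ℝ) - 1) / 2) = (1 - ε ^ 2) * L := by
      rw [hHsq, ← htL]; ring
    have : -((1 + ε) * H ^ 2) * (((d : ℝ) - 1) / 2) ≤
        Real.log (1 - H ^ 2) * (((d : ℝ) - 1) / 2) := by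
      gcongr
    linarith
  have hM := le_mul_one_sub_capCdf hd3 hH0.le hH1 (η := 2 * ε * t) (by positivity) (by nlinarith)
  have e : 2 * ε * t * ((d : ℝ) - 1) / 2 = ε * L := by rw [← htL]; ring
  rw [e, ← hE, ← hS] at hM
  have hexpL : Real.exp (-L) = d / n := by
    rw [Real.exp_neg, hL, Real.exp_log (by positivity), inv_div]
  have hkey : 2 * (((d : ℝ) - 1) * S) ≤ c1 d * E * Real.exp (ε ^ 2 * L) := by
    refine le_of_sq_le_sq ?_ (by positivity)
    have hexp2 : Real.exp (ε ^ 2 * L) ^ 2 = Real.exp (2 * (ε ^ 2 * L)) := by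
      rw [← Real.exp_nat_mul, Nat.cast_ofNat]
    calc (2 * (((d : ℝ) - 1) * S)) ^ 2 = 8 * L * (d - 1) := by
          rw [mul_pow, mul_pow, hSsq, ← htL]; ring
      _ ≤ 16 * L * (d - 2) := by nlinarith
      _ = (d - 2) / (2 * Real.pi) * (1 / 2) ^ 2 * (128 * Real.pi * L) := by field_simp; ring
      _ ≤ c1 d ^ 2 * E ^ 2 * Real.exp (2 * (ε ^ 2 * L)) := by gcongr
      _ = _ := by rw [mul_pow, mul_pow, hexp2]
  have hp : 2 * d / n ≤ 1 - capCdf d H := by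
    refine le_of_mul_le_mul_left (le_trans ?_ hM) (by positivity : 0 < ((d : ℝ) - 1) * S)
    calc ((d : ℝ) - 1) * S * (2 * d / n) = 2 * (((d : ℝ) - 1) * S) * Real.exp (-L) := by
          rw [hexpL]; ring
      _ ≤ c1 d * E * Real.exp (ε ^ 2 * L) * Real.exp (-L) := by gcongr
      _ = c1 d * (Real.exp (-L) * Real.exp (ε ^ 2 * L) * E) := by ring
      _ ≤ _ := by gcongr
  have hq : ∀ h, -1 ≤ h → h ≤ 1 → 1 - capCdf d h < 1 - capCdf d H →
      K * (1 - capCdf d h) ≤ capProfile d h := by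
    intro h hl hr hlt
    have hHh : H ≤ h := by
      by_contra! hcon
      have := capCdf_mono hd3 hl hcon.le hH1
      linarith
    have hp := sub_nonneg.2 (capCdf_le_one hd3 hl hr)
    rw [hK, div_mul_eq_mul_div, div_le_iff₀ hc]
    calc _ ≤ ((d : ℝ) - 1) * h * (1 - capCdf d h) := by gcongr
      _ ≤ _ := mul_one_sub_capCdf_le hd3 (hH0.le.trans hHh) hr
      _ = _ := mul_comm _ _
  have hF := le_FF hd3 hn hK0 hKn hp hq
  have hF' := Real.rpow_le_rpow (by positivity) hF (show 0 ≤ 2 / ((d : ℝ) - 1) by positivity)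
  rw [Real.div_rpow (by positivity) (by positivity), pow_sub_one_rpow_two_div (by lia) hK0.le] at hF'
  rw [le_div_iff₀ hL0]
  refine le_trans ?_ hF'
  rw [div_mul_eq_mul_div]
  gcongr
  rw [hKsq]
  calc _ = 2 * (1 - ε) * L * (d - 1) / (((d : ℝ) - 1) / (2 * Real.pi)) := by field_simp; ring
    _ ≤ _ := by gcongr

theorem tendsto_mul_sq_rpow_two_div {d : ℕ → ℕ} {c : ℝ} (hc : 0 < c)
    (hdi : Tendsto (fun n : ℕ => (d n : ℝ)) atTop atTop)
    (hln : Tendsto (fun n : ℕ => Real.log n / (d n : ℝ)) atTop (nhds 0)) :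
    Tendsto (fun n : ℕ => (c * (n : ℝ) ^ 2) ^ (2 / ((d n : ℝ) - 1))) atTop (nhds 1) := by
  have hinv : Tendsto (fun n : ℕ => ((d n : ℝ))⁻¹) atTop (nhds 0) := tendsto_inv_atTop_zero.comp hdi
  have hlim : Tendsto (fun n : ℕ => (Real.log c * (d n : ℝ)⁻¹ + 2 * (Real.log n / d n)) *
      (2 / (1 - (d n : ℝ)⁻¹))) atTop (nhds ((Real.log c * 0 + 2 * 0) * (2 / (1 - 0)))) :=
    ((hinv.const_mul _).add (hln.const_mul _)).mul
      (tendsto_const_nhds.div (tendsto_const_nhds.sub hinv) (by norm_num))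
  have hexp := (Real.continuous_exp.tendsto _).comp hlim
  simp only [mul_zero, add_zero, zero_mul, Real.exp_zero] at hexp
  refine hexp.congr' ?_
  filter_upwards [hdi.eventually_ge_atTop 2, eventually_gt_atTop 0] with n hd hn
  have hn0 : (0 : ℝ) < n := by exact_mod_cast hn
  have hd1 : (d n : ℝ) - 1 ≠ 0 := by linarith
  have hd0 : (d n : ℝ) ≠ 0 := by linarith
  have hinv1 : 1 - (d n : ℝ)⁻¹ ≠ 0 := by
    rw [sub_ne_zero]; intro h
    exact hd1 (by rw [eq_comm, inv_eq_one] at h; linarith)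
  rw [Real.rpow_def_of_pos (by positivity), Real.log_mul hc.ne' (by positivity), Real.log_pow,
    Function.comp_apply]
  congr 1
  push_cast
  have : 1 - (d n : ℝ)⁻¹ = ((d n : ℝ) - 1) / d n := by field_simp
  rw [this]
  field_simp

/-- in the subexponential regime (`d → ∞`, `ln n ≪ d ≪ n`), the expected
number of facets satisfies `F = [(4π+o(1))·ln(n/d)]^{(d-1)/2}`. -/
theorem facet_count_subexponential (d : ℕ → ℕ)
    (hd : ∀ᶠ n in atTop, 2 ≤ d n ∧ d n < n)
    (hdi : Tendsto (fun n : ℕ => (d n : ℝ)) atTop atTop)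
    (hln : Tendsto (fun n : ℕ => Real.log n / (d n : ℝ)) atTop (nhds 0))
    (hdn : Tendsto (fun n : ℕ => (d n : ℝ) / (n : ℝ)) atTop (nhds 0)) :
    Tendsto (fun n : ℕ =>
        (FF n (d n) (-1) 1) ^ (2 / ((d n : ℝ) - 1)) / Real.log ((n : ℝ) / (d n : ℝ)))
      atTop (nhds (4 * Real.pi)) := by
  have hpi := Real.pi_pos
  have hlog : Tendsto (fun n : ℕ => Real.log ((n : ℝ) / (d n : ℝ))) atTop atTop := by
    refine Real.tendsto_log_atTop.comp ?_
    have : Tendsto (fun n : ℕ => (d n : ℝ) / (n : ℝ)) atTop (nhdsWithin 0 (Set.Ioi 0)) := by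
      refine tendsto_nhdsWithin_iff.2 ⟨hdn, ?_⟩
      filter_upwards [hd] with n hn
      have h1 : 0 < d n := by lia
      have h2 : 0 < n := by lia
      exact Set.mem_Ioi.2 (by positivity)
    exact (tendsto_inv_nhdsGT_zero.comp this).congr fun n => by simp
  have hinv : Tendsto (fun n : ℕ => ((d n : ℝ))⁻¹) atTop (nhds 0) := tendsto_inv_atTop_zero.comp hdi
  have hLd : Tendsto (fun n : ℕ => Real.log ((n : ℝ) / (d n : ℝ)) / ((d n : ℝ) - 1)) atTop
      (nhds 0) := by
    refine squeeze_zero' ?_ ?_ (by simpa using hln.const_mul 2)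
    · filter_upwards [hlog.eventually_ge_atTop 0, hdi.eventually_ge_atTop 2] with n h1 h2
      exact div_nonneg h1 (by linarith)
    · filter_upwards [hd, hdi.eventually_ge_atTop 2, eventually_ge_atTop 1] with n h1 h2 h3
      have hn1 : (1 : ℝ) ≤ n := by exact_mod_cast h3
      rw [Real.log_div (by positivity) (by positivity), ← mul_div_assoc,
        div_le_div_iff₀ (by linarith) (by positivity)]
      have l1 := Real.log_nonneg hn1
      have l2 := Real.log_nonneg (show (1 : ℝ) ≤ d n by linarith)
      nlinarith
  have hratio : Tendsto (fun n : ℕ => ((d n : ℝ) - 1) / ((d n : ℝ) - 2)) atTop (nhds 1) := by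
    have : Tendsto (fun n : ℕ => (1 - (d n : ℝ)⁻¹) / (1 - 2 * (d n : ℝ)⁻¹)) atTop
        (nhds ((1 - 0) / (1 - 2 * 0))) :=
      (tendsto_const_nhds.sub hinv).div (tendsto_const_nhds.sub (hinv.const_mul 2)) (by norm_num)
    rw [show ((1 : ℝ) - 0) / (1 - 2 * 0) = 1 by norm_num] at this
    refine this.congr' ?_
    filter_upwards [hdi.eventually_ge_atTop 3] with n hn
    have h0 : (d n : ℝ) ≠ 0 := by linarith
    rw [← mul_div_mul_left _ _ h0]
    congr 1 <;> field_simp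
  have hexp0 : ∀ ε : ℝ, 0 < ε → Tendsto (fun n : ℕ =>
      Real.exp (-(ε * Real.log ((n : ℝ) / (d n : ℝ))))) atTop (nhds 0) := fun ε hε =>
    Real.tendsto_exp_neg_atTop_nhds_zero.comp (hlog.const_mul_atTop hε)
  have hd4 : ∀ᶠ n in atTop, 4 ≤ d n := by
    filter_upwards [hdi.eventually_ge_atTop 4] with n hn
    exact_mod_cast hn
  rw [tendsto_order]
  constructor
  · intro a ha
    obtain ⟨ε, hε0, hε1, hεa⟩ : ∃ ε : ℝ, 0 < ε ∧ ε < 1 ∧ a < 4 * Real.pi * (1 - ε) := by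
      have hlim : Tendsto (fun ε : ℝ => 4 * Real.pi * (1 - ε)) (nhdsWithin 0 (Set.Ioi 0))
          (nhds (4 * Real.pi * (1 - 0))) :=
        (Continuous.tendsto (by fun_prop) 0).mono_left nhdsWithin_le_nhds
      rw [sub_zero, mul_one] at hlim
      obtain ⟨ε, h1, h2⟩ := ((hlim.eventually_const_lt ha).and
        (Ioo_mem_nhdsGT (zero_lt_one' ℝ))).exists
      exact ⟨ε, h2.1, h2.2, h1⟩
    have hlim : Tendsto (fun n : ℕ => 4 * Real.pi * (1 - ε) /
        ((n : ℝ) ^ 2) ^ (2 / ((d n : ℝ) - 1))) atTop (nhds (4 * Real.pi * (1 - ε) / 1)) := by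
      have := tendsto_mul_sq_rpow_two_div one_pos hdi hln
      simp only [one_mul] at this
      exact tendsto_const_nhds.div this one_ne_zero
    rw [div_one] at hlim
    have hbig : ∀ᶠ n : ℕ in atTop, 128 * Real.pi * Real.log ((n : ℝ) / (d n : ℝ)) ≤
        Real.exp (2 * (ε ^ 2 * Real.log ((n : ℝ) / (d n : ℝ)))) := by
      have h1 := (Real.tendsto_exp_div_pow_atTop 1).comp
        (hlog.const_mul_atTop (show 0 < 2 * ε ^ 2 by positivity))
      filter_upwards [h1.eventually_ge_atTop (64 * Real.pi / ε ^ 2), hlog.eventually_gt_atTop 0]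
        with n hn hL
      rw [Function.comp_apply, pow_one, le_div_iff₀ (by positivity)] at hn
      rw [← mul_assoc 2]
      refine le_trans (le_of_eq ?_) hn
      field_simp; ring
    filter_upwards [hlim.eventually_const_lt hεa, hd, hd4, hlog.eventually_ge_atTop 1,
      (hLd.const_mul 2).eventually_le_const (show 2 * 0 < ε / 2 by linarith),
      (hexp0 ε hε0).eventually_le_const (show (0 : ℝ) < 1 / 2 by norm_num), hbig]
      with n g1 g2 g3 g4 g5 g6 g7
    exact g1.trans_le (le_FF_rpow_div g3 g2.2.le hε0 hε1 rfl g4 g5 g6 g7)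
  · intro a ha
    obtain ⟨ε, hε0, hεa⟩ : ∃ ε : ℝ, 0 < ε ∧ 4 * Real.pi * (1 + 2 * ε) < a := by
      have hlim : Tendsto (fun ε : ℝ => 4 * Real.pi * (1 + 2 * ε)) (nhdsWithin 0 (Set.Ioi 0))
          (nhds (4 * Real.pi * (1 + 2 * 0))) :=
        (Continuous.tendsto (by fun_prop) 0).mono_left nhdsWithin_le_nhds
      rw [mul_zero, add_zero, mul_one] at hlim
      obtain ⟨ε, h1, h2⟩ := ((hlim.eventually_lt_const ha).and self_mem_nhdsWithin).exists
      exact ⟨ε, h2, h1⟩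
    have hlim : Tendsto (fun n : ℕ => 4 * Real.pi * (1 + 2 * ε) * (((d n : ℝ) - 1) / (d n - 2)) /
        (1 - Real.exp (-(ε * Real.log ((n : ℝ) / (d n : ℝ))))) ^ 2 *
          (4 * (n : ℝ) ^ 2) ^ (2 / ((d n : ℝ) - 1))) atTop
        (nhds (4 * Real.pi * (1 + 2 * ε) * 1 / (1 - 0) ^ 2 * 1)) :=
      ((hratio.const_mul _).div ((tendsto_const_nhds.sub (hexp0 ε hε0)).pow 2) (by norm_num)).mul
        (tendsto_mul_sq_rpow_two_div four_pos hdi hln)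
    rw [mul_one, mul_one, sub_zero, one_pow, div_one] at hlim
    filter_upwards [hlim.eventually_lt_const hεa, hd, hd4, hlog.eventually_ge_atTop 1,
      (hdi.const_mul_atTop hε0).eventually_ge_atTop (4 * (1 + ε)),
      (hlog.const_mul_atTop hε0).eventually_ge_atTop 2,
      (hLd.const_mul (2 * (1 + 2 * ε))).eventually_le_const
        (show 2 * (1 + 2 * ε) * 0 < 1 by norm_num)] with n g1 g2 g3 g4 g5 g6 g7
    exact (FF_rpow_div_le (by lia) g2.2.le hε0 rfl g4 g5 g6 g7).trans_lt g1
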